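/- On ℝ⁷ with the standard G₂ 4-form ∗φ and associated cross product P, let n ∈ ℝ⁷ be a unit vector and define the 2-form ω_n by ω_n(x,y) = ⟨x, P(n,y)⟩. Then for all vectors x, y, z, u orthogonal to n: ∗φ(x, y, z, u) = −(1/2)(ω_n ∧ ω_n)(x, y, z, u). (This says the restriction of ∗φ to the hyperplane n^⊥ equals −½ ω ∧ ω for the Kähler form ω of the induced SU(3)-structure.) -/

import Mathlib

open scoped BigOperators

noncomputable section

/-- ℝ⁷ as the space of functions `Fin 7 → ℝ` (indices in ℤ/7ℤ). -/
abbrev V7 : Type := Fin 7 → ℝ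

/-- The standard inner product on ℝ⁷. -/
def ip7 (x y : V7) : ℝ := ∑ i, x i * y i

/-- The standard orthonormal basis vector `e_i`. -/
def e7 (i : Fin 7) : V7 := fun j => if j = i then 1 else 0

/-- The G₂ fundamental 3-form `φ = ∑_{i∈ℤ/7} eⁱ ∧ e^{i+1} ∧ e^{i+3}`
(each wedge of covectors in the determinant convention). -/
def φ7 (x y z : V7) : ℝ :=
  ∑ i : Fin 7,
    (x i * y (i + 1) * z (i + 3) - x i * y (i + 3) * z (i + 1)
      - x (i + 1) * y i * z (i + 3) + x (i + 1) * y (i + 3) * z i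
      + x (i + 3) * y i * z (i + 1) - x (i + 3) * y (i + 1) * z i)

/-- The 4-form `∗φ = −∑_{i∈ℤ/7} e^{i+2} ∧ e^{i+4} ∧ e^{i+5} ∧ e^{i+6}`. -/
def sφ7 (x y z u : V7) : ℝ :=
  -∑ i : Fin 7,
    Matrix.det !![x (i + 2), x (i + 4), x (i + 5), x (i + 6);
                  y (i + 2), y (i + 4), y (i + 5), y (i + 6);
                  z (i + 2), z (i + 4), z (i + 5), z (i + 6);
                  u (i + 2), u (i + 4), u (i + 5), u (i + 6)]

/-- Wedge product of two 2-forms, as an alternating 4-form: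
`(β ∧ γ)(v) = (1/(2!2!)) ∑_{σ ∈ S₄} sgn σ · β(v_{σ0},v_{σ1}) γ(v_{σ2},v_{σ3})`. -/
def w22 (β γ : V7 → V7 → ℝ) (v : Fin 4 → V7) : ℝ :=
  (1 / 4 : ℝ) * ∑ σ : Equiv.Perm (Fin 4),
    ((Equiv.Perm.sign σ : ℤ) : ℝ) *
      (β (v (σ 0)) (v (σ 1)) * γ (v (σ 2)) (v (σ 3)))


/-- Expansion of a 4 × 4 determinant given by its rows. -/
theorem det_four (a0 a1 a2 a3 b0 b1 b2 b3 c0 c1 c2 c3 d0 d1 d2 d3 : ℝ) :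
    Matrix.det !![a0, a1, a2, a3; b0, b1, b2, b3; c0, c1, c2, c3; d0, d1, d2, d3]
      = (a0 * b1 - a1 * b0) * (c2 * d3 - c3 * d2) - (a0 * b2 - a2 * b0) * (c1 * d3 - c3 * d1)
      + (a0 * b3 - a3 * b0) * (c1 * d2 - c2 * d1) + (a1 * b2 - a2 * b1) * (c0 * d3 - c3 * d0)
      - (a1 * b3 - a3 * b1) * (c0 * d2 - c2 * d0) + (a2 * b3 - a3 * b2) * (c0 * d1 - c1 * d0) := by
  simp [Matrix.det_succ_row_zero, Fin.sum_univ_succ, Fin.succAbove]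
  ring

set_option maxHeartbeats 0 in
/-- The polynomial identity behind the theorem, valid for all vectors. -/
theorem key_identity (n x y z u : V7) :
    sφ7 x y z u * ip7 n n = ip7 n x * sφ7 n y z u + ip7 n y * sφ7 x n z u
      + ip7 n z * sφ7 x y n u + ip7 n u * sφ7 x y z n
      - (φ7 n y x * φ7 n u z - φ7 n z x * φ7 n u y + φ7 n u x * φ7 n z y) := by
  simp only [sφ7, φ7, ip7, det_four, Fin.sum_univ_seven, Fin.reduceAdd, Fin.isValue, zero_add]
  ring

theorem wedge_expand (β : V7 → V7 → ℝ) (hβ : ∀ a b, β b a = - β a b) (x y z u : V7) :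
    w22 β β ![x, y, z, u] = 2 * (β x y * β z u - β x z * β y u + β x u * β y z) := by
  unfold w22
  rw [← Equiv.sum_comp (Equiv.Perm.decomposeFin (n := 3)).symm, Fintype.sum_prod_type]
  simp_rw [← Equiv.sum_comp (Equiv.Perm.decomposeFin (n := 2)).symm, Fintype.sum_prod_type]
  simp_rw [← Equiv.sum_comp (Equiv.Perm.decomposeFin (n := 1)).symm, Fintype.sum_prod_type]
  have h42 (p : Fin 4) (e : Equiv.Perm (Fin 3)) :
      Equiv.Perm.decomposeFin.symm (p, e) 2 = Equiv.swap 0 p (e 1).succ :=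
    Equiv.Perm.decomposeFin_symm_apply_succ e p 1
  have h43 (p : Fin 4) (e : Equiv.Perm (Fin 3)) :
      Equiv.Perm.decomposeFin.symm (p, e) 3 = Equiv.swap 0 p (e 2).succ :=
    Equiv.Perm.decomposeFin_symm_apply_succ e p 2
  have h32 (p : Fin 3) (e : Equiv.Perm (Fin 2)) :
      Equiv.Perm.decomposeFin.symm (p, e) 2 = Equiv.swap 0 p (e 1).succ :=
    Equiv.Perm.decomposeFin_symm_apply_succ e p 1
  simp [h42, h43, h32, Fin.sum_univ_succ, Equiv.Perm.decomposeFin.symm_sign,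
    Equiv.swap_apply_def]
  rw [hβ x y, hβ x z, hβ x u, hβ y z, hβ y u, hβ z u]
  ring

theorem phi_antisymm (n x y : V7) : φ7 n x y = - φ7 n y x := by
  simp only [φ7, ← Finset.sum_neg_distrib]
  exact Finset.sum_congr rfl fun i _ => by ring

/-- For a unit vector `n` and `x, y, z, u ⟂ n`:
`∗φ(x,y,z,u) = −(1/2)(ω_n ∧ ω_n)(x,y,z,u)`, where `ω_n(x,y) = ⟨x, P(n,y)⟩`. -/
theorem star_phi_restriction (P : V7 → V7 → V7)
    (hP : ∀ x y z : V7, ip7 (P x y) z = φ7 x y z)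
    (n : V7) (hn : ip7 n n = 1) :
    ∀ x y z u : V7, ip7 n x = 0 → ip7 n y = 0 → ip7 n z = 0 → ip7 n u = 0 →
      sφ7 x y z u
        = -(1 / 2 : ℝ) * w22 (fun a b => ip7 a (P n b)) (fun a b => ip7 a (P n b)) ![x, y, z, u] := by
  intro x y z u hx hy hz hu
  have hw : (fun a b => ip7 a (P n b)) = fun a b => φ7 n b a := by
    funext a b
    rw [← hP]
    simp only [ip7, mul_comm]
  rw [hw, wedge_expand _ (fun a b => phi_antisymm n a b)]
  have := key_identity n x y z u
  rw [hn, hx, hy, hz, hu] at this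
  linear_combination this
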